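/- arXiv:1101.3420 — 5 statements merged into one kernel-verified Lean document; each statement's English description precedes it below -/
import Mathlib

section
/- Any ap-basic class [x]_ap is positively F-invariant: F([x]_ap) ⊆ [x]_ap. If moreover closure([x]_ap) ⊆ M_1 (so that [x]_ap is closed), then it is F-invariant: F([x]_ap) = [x]_ap. -/
open MeasureTheory ProbabilityTheory Metric Set Filter Topology
open scoped ENNReal NNReal

noncomputable section

namespace QSDPaper

variable {d : ℕ}

/-- An absorption-preserving (ap) `δ`-pseudoorbit `ξ_0, …, ξ_n` in `M`. -/
def IsApOrbit (F : (Fin d → ℝ) → Fin d → ℝ) (M M0 : Set (Fin d → ℝ)) (δ : ℝ)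
    (n : ℕ) (ξ : ℕ → Fin d → ℝ) : Prop :=
  1 ≤ n ∧ (∀ i ≤ n, ξ i ∈ M) ∧ (∀ i < n, ξ i ∈ M0 → ξ (i + 1) ∈ M0) ∧
    ∀ i < n, dist (ξ (i + 1)) (F (ξ i)) < δ

/-- `x <_ap y`: for every `δ > 0` there is an ap `δ`-pseudoorbit joining `x` to `y`. -/
def apLe (F : (Fin d → ℝ) → Fin d → ℝ) (M M0 : Set (Fin d → ℝ)) (x y : Fin d → ℝ) : Prop :=
  ∀ δ > (0 : ℝ), ∃ n ξ, IsApOrbit F M M0 δ n ξ ∧ ξ 0 = x ∧ ξ n = y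

/-- `x ∼_ap y`. -/
def apEquiv (F : (Fin d → ℝ) → Fin d → ℝ) (M M0 : Set (Fin d → ℝ)) (x y : Fin d → ℝ) : Prop :=
  apLe F M M0 x y ∧ apLe F M M0 y x

/-- The set `R_ap` of ap-chain recurrent points. -/
def apRec (F : (Fin d → ℝ) → Fin d → ℝ) (M M0 : Set (Fin d → ℝ)) : Set (Fin d → ℝ) :=
  {x | apEquiv F M M0 x x}

/-- The ap-basic class of `x`. -/
def apClass (F : (Fin d → ℝ) → Fin d → ℝ) (M M0 : Set (Fin d → ℝ)) (x : Fin d → ℝ) :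
    Set (Fin d → ℝ) :=
  {y | y ∈ apRec F M M0 ∧ apEquiv F M M0 x y}

/-- `[x]_ap` is a maximal ap-basic class. -/
def IsApQuasiattractor (F : (Fin d → ℝ) → Fin d → ℝ) (M M0 : Set (Fin d → ℝ))
    (x : Fin d → ℝ) : Prop :=
  x ∈ apRec F M M0 ∧ ∀ y ∈ apRec F M M0, apLe F M M0 x y → apEquiv F M M0 x y

/-- A compact set `A` is an attractor for `F : M → M`. -/
def IsAttractor (F : (Fin d → ℝ) → Fin d → ℝ) (M A : Set (Fin d → ℝ)) : Prop :=
  IsCompact A ∧ A ⊆ M ∧ ∃ U : Set (Fin d → ℝ), IsOpen U ∧ A ⊆ U ∧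
    (⋂ n ∈ {k : ℕ | 1 ≤ k}, F^[n] '' (U ∩ M)) = A ∧
    ∀ V : Set (Fin d → ℝ), IsOpen V → A ⊆ V → ∃ N : ℕ, ∀ n ≥ N, F^[n] '' (U ∩ M) ⊆ V

/-- The ω-limit set of `x` under `F`. -/
def omegaSet (F : (Fin d → ℝ) → Fin d → ℝ) (x : Fin d → ℝ) : Set (Fin d → ℝ) :=
  {y | ∃ φ : ℕ → ℕ, StrictMono φ ∧ Tendsto (fun k => F^[φ k] x) atTop (𝓝 y)}

/-- The nonwandering set of `F` on `M`. -/
def nonwanderingSet (F : (Fin d → ℝ) → Fin d → ℝ) (M : Set (Fin d → ℝ)) :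
    Set (Fin d → ℝ) :=
  {x ∈ M | ∀ U : Set (Fin d → ℝ), IsOpen U → x ∈ U → ∀ N : ℕ,
    ∃ n ≥ N, ((F^[n] '' (U ∩ M)) ∩ (U ∩ M)).Nonempty}

/-- `β_δ(ε) = sup_{x ∈ M} p^ε(x, M \ N^δ(F x))`. -/
def beta (p : ℝ → Kernel (Fin d → ℝ) (Fin d → ℝ)) (F : (Fin d → ℝ) → Fin d → ℝ)
    (M : Set (Fin d → ℝ)) (δ ε : ℝ) : ℝ≥0∞ :=
  ⨆ x ∈ M, p ε x (M \ ball (F x) δ)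

/-- `μ` is a quasi-stationary distribution for `κ` on `M1` with eigenvalue `lam ∈ (0,1)`. -/
def IsQSD (κ : Kernel (Fin d → ℝ) (Fin d → ℝ)) (M1 : Set (Fin d → ℝ))
    (μ : Measure (Fin d → ℝ)) (lam : ℝ) : Prop :=
  IsProbabilityMeasure μ ∧ μ M1 = 1 ∧ 0 < lam ∧ lam < 1 ∧
    ∀ Γ : Set (Fin d → ℝ), MeasurableSet Γ → Γ ⊆ M1 →
      ∫⁻ x in M1, κ x Γ ∂μ = ENNReal.ofReal lam * μ Γ

/-- Weak* convergence of a sequence of measures (tested against bounded continuous functions). -/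
def WeaklyTendsto (μs : ℕ → Measure (Fin d → ℝ)) (μ : Measure (Fin d → ℝ)) : Prop :=
  ∀ g : BoundedContinuousFunction (Fin d → ℝ) ℝ,
    Tendsto (fun n => ∫ x, g x ∂μs n) atTop (𝓝 (∫ x, g x ∂μ))

/-- `stayProb κ V n x = P_x[X_0, …, X_n ∈ V] = P_x[τ_V > n]` for the Markov chain with
transition kernel `κ` started at `x`, where `τ_V = min {n : X_n ∉ V}`. -/
def stayProb (κ : Kernel (Fin d → ℝ) (Fin d → ℝ)) (V : Set (Fin d → ℝ)) :
    ℕ → (Fin d → ℝ) → ℝ≥0∞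
  | 0, x => V.indicator 1 x
  | n + 1, x => V.indicator (fun z => ∫⁻ y, stayProb κ V n y ∂κ z) x

/-- `tubeProb κ η n ξ x = P_x[dist (X_j, ξ_j) < η for j = 1, …, n]` for the Markov chain
with transition kernel `κ` started at `x`. -/
def tubeProb (κ : Kernel (Fin d → ℝ) (Fin d → ℝ)) (η : ℝ) :
    ℕ → (ℕ → Fin d → ℝ) → (Fin d → ℝ) → ℝ≥0∞
  | 0, _, _ => 1
  | n + 1, ξ, x => ∫⁻ y in ball (ξ 1) η, tubeProb κ η n (fun k => ξ (k + 1)) y ∂κ x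

/-- `A_n(ξ) = Σ_{i<n} ρ(ξ_i, ξ_{i+1})`. -/
def rhoCost (ρ : (Fin d → ℝ) → (Fin d → ℝ) → ℝ≥0∞) (n : ℕ) (ξ : ℕ → Fin d → ℝ) : ℝ≥0∞ :=
  ∑ i ∈ Finset.range n, ρ (ξ i) (ξ (i + 1))

/-- `B_ρ(x,y)`: minimal cost of a finite path in `M` from `x` to `y`. -/
def Brho (ρ : (Fin d → ℝ) → (Fin d → ℝ) → ℝ≥0∞) (M : Set (Fin d → ℝ))
    (x y : Fin d → ℝ) : ℝ≥0∞ :=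
  ⨅ (n : ℕ) (_ : 1 ≤ n) (ξ : ℕ → Fin d → ℝ)
    (_ : (∀ i ≤ n, ξ i ∈ M) ∧ ξ 0 = x ∧ ξ n = y), rhoCost ρ n ξ

/-- `x <_ρ y`. -/
def rhoLe (ρ : (Fin d → ℝ) → (Fin d → ℝ) → ℝ≥0∞) (M : Set (Fin d → ℝ))
    (x y : Fin d → ℝ) : Prop :=
  Brho ρ M x y = 0

/-- `x ∼_ρ y`. -/
def rhoEquiv (ρ : (Fin d → ℝ) → (Fin d → ℝ) → ℝ≥0∞) (M : Set (Fin d → ℝ))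
    (x y : Fin d → ℝ) : Prop :=
  rhoLe ρ M x y ∧ rhoLe ρ M y x

/-- The ρ-chain recurrent set `R_ρ`. -/
def rhoRec (ρ : (Fin d → ℝ) → (Fin d → ℝ) → ℝ≥0∞) (M : Set (Fin d → ℝ)) :
    Set (Fin d → ℝ) :=
  {x | rhoEquiv ρ M x x}

/-- The ρ-basic class of `x`. -/
def rhoClass (ρ : (Fin d → ℝ) → (Fin d → ℝ) → ℝ≥0∞) (M : Set (Fin d → ℝ))
    (x : Fin d → ℝ) : Set (Fin d → ℝ) :=
  {y | y ∈ rhoRec ρ M ∧ rhoEquiv ρ M x y}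

/-- `[x]_ρ` is a maximal ρ-basic class. -/
def IsRhoQuasiattractor (ρ : (Fin d → ℝ) → (Fin d → ℝ) → ℝ≥0∞) (M : Set (Fin d → ℝ))
    (x : Fin d → ℝ) : Prop :=
  x ∈ rhoRec ρ M ∧ ∀ y ∈ rhoRec ρ M, rhoLe ρ M x y → rhoEquiv ρ M x y

/-- Properties (i)–(iii) of Hypothesis 2.4 for the rate function `ρ`. -/
def HypRho (F : (Fin d → ℝ) → Fin d → ℝ) (M M0 : Set (Fin d → ℝ))
    (ρ : (Fin d → ℝ) → (Fin d → ℝ) → ℝ≥0∞) : Prop :=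
  ContinuousOn (fun q : (Fin d → ℝ) × (Fin d → ℝ) => ρ q.1 q.2) ((M \ M0) ×ˢ M) ∧
  (∀ x ∈ M, ∀ y ∈ M, (ρ x y = 0 ↔ y = F x)) ∧
  (∀ β : ℝ, 0 < β → ∃ c : ℝ≥0∞, 0 < c ∧ ∀ x ∈ M, ∀ y ∈ M, β < dist (F x) y → c ≤ ρ x y)

/-- Property (iv) of Hypothesis 2.4: large deviation upper and lower bounds. -/
def HypLD (p : ℝ → Kernel (Fin d → ℝ) (Fin d → ℝ)) (F : (Fin d → ℝ) → Fin d → ℝ)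
    (M M0 : Set (Fin d → ℝ)) (ρ : (Fin d → ℝ) → (Fin d → ℝ) → ℝ≥0∞) : Prop :=
  (∀ K : Set (Fin d → ℝ), IsCompact K → K ⊆ M \ M0 → ∀ z : Fin d → ℝ, ∀ r > (0 : ℝ),
    ∀ η > (0 : ℝ), ∀ᶠ ε : ℝ in 𝓝[>] (0 : ℝ), ∀ x ∈ K,
      -(((⨅ y ∈ ball z r ∩ M, ρ x y : ℝ≥0∞) : EReal)) - (η : EReal)
        ≤ (ε : EReal) * ENNReal.log (p ε x (ball z r ∩ M))) ∧
  (∀ C : Set (Fin d → ℝ), IsClosed C → C ⊆ M → ∀ η > (0 : ℝ),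
    ∀ᶠ ε : ℝ in 𝓝[>] (0 : ℝ), ∀ x ∈ M,
      (ε : EReal) * ENNReal.log (p ε x C) + ((⨅ y ∈ C, ρ x y : ℝ≥0∞) : EReal) ≤ (η : EReal))

/-- Hypothesis 2.5: absorption is not too unlikely near the absorbing set. -/
def HypAbs (p : ℝ → Kernel (Fin d → ℝ) (Fin d → ℝ)) (M M0 : Set (Fin d → ℝ)) : Prop :=
  ∀ c > (0 : ℝ), ∃ V0 : Set (Fin d → ℝ), IsOpen V0 ∧ M0 ⊆ V0 ∧
    (-(c : EReal)) ≤
      Filter.liminf (fun ε : ℝ => ⨅ x ∈ V0 ∩ M, (ε : EReal) * ENNReal.log (p ε x M0))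
        (𝓝[>] (0 : ℝ))

/-- The (topological) support of a measure. -/
def measSupport (μ : Measure (Fin d → ℝ)) : Set (Fin d → ℝ) :=
  {x | ∀ U : Set (Fin d → ℝ), IsOpen U → x ∈ U → 0 < μ U}

/-- One step of an ap pseudoorbit. -/
def ApStep (F : (Fin d → ℝ) → Fin d → ℝ) (M M0 : Set (Fin d → ℝ)) (δ : ℝ)
    (a b : Fin d → ℝ) : Prop :=
  a ∈ M ∧ b ∈ M ∧ (a ∈ M0 → b ∈ M0) ∧ dist b (F a) < δ

theorem apStep_of_orbit {F : (Fin d → ℝ) → Fin d → ℝ} {M M0 : Set (Fin d → ℝ)} {δ : ℝ}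
    {n : ℕ} {ξ : ℕ → Fin d → ℝ} (h : IsApOrbit F M M0 δ n ξ) :
    Relation.TransGen (ApStep F M M0 δ) (ξ 0) (ξ n) := by
  obtain ⟨h1, h2, h3, h4⟩ := h
  have key : ∀ m, m + 1 ≤ n → Relation.TransGen (ApStep F M M0 δ) (ξ 0) (ξ (m + 1)) := by
    intro m
    induction m with
    | zero =>
      intro hm
      exact Relation.TransGen.single ⟨h2 _ (by omega), h2 _ hm, h3 _ (by omega), h4 _ (by omega)⟩
    | succ k ih =>
      intro hm
      exact (ih (by omega)).tail
        ⟨h2 _ (by omega), h2 _ hm, h3 _ (by omega), h4 _ (by omega)⟩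
  have := key (n - 1) (by omega)
  rwa [Nat.sub_add_cancel h1] at this

theorem orbit_of_apStep {F : (Fin d → ℝ) → Fin d → ℝ} {M M0 : Set (Fin d → ℝ)} {δ : ℝ}
    {x y : Fin d → ℝ} (h : Relation.TransGen (ApStep F M M0 δ) x y) :
    ∃ n ξ, IsApOrbit F M M0 δ n ξ ∧ ξ 0 = x ∧ ξ n = y := by
  induction h with
  | @single b hb =>
    obtain ⟨a1, a2, a3, a4⟩ := hb
    refine ⟨1, fun i => if i = 0 then x else b, ⟨le_refl _, ?_, ?_, ?_⟩, by simp, by simp⟩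
    · intro i _
      by_cases h : i = 0 <;> simp [h, a1, a2]
    · intro i hi
      obtain rfl : i = 0 := by omega
      simpa using a3
    · intro i hi
      obtain rfl : i = 0 := by omega
      simpa using a4
  | @tail b c _ hbc ih =>
    obtain ⟨a1, a2, a3, a4⟩ := hbc
    obtain ⟨n, ξ, ⟨h1, h2, h3, h4⟩, h5, h6⟩ := ih
    refine ⟨n + 1, fun i => if i ≤ n then ξ i else c, ⟨by omega, ?_, ?_, ?_⟩, by simpa using h5,
      by simp⟩
    · intro i _
      by_cases h : i ≤ n
      · simpa [h] using h2 i h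
      · simpa [h] using a2
    · intro i hi
      by_cases h : i + 1 ≤ n
      · simpa [h, (by omega : i ≤ n)] using h3 i h
      · obtain rfl : i = n := by omega
        simpa [h6] using a3
    · intro i hi
      by_cases h : i + 1 ≤ n
      · simpa [h, (by omega : i ≤ n)] using h4 i h
      · obtain rfl : i = n := by omega
        simpa [h6] using a4

theorem apLe_iff {F : (Fin d → ℝ) → Fin d → ℝ} {M M0 : Set (Fin d → ℝ)} {x y : Fin d → ℝ} :
    apLe F M M0 x y ↔ ∀ δ > (0 : ℝ), Relation.TransGen (ApStep F M M0 δ) x y := by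
  constructor
  · intro h δ hδ
    obtain ⟨n, ξ, ho, rfl, rfl⟩ := h δ hδ
    exact apStep_of_orbit ho
  · intro h δ hδ
    exact orbit_of_apStep (h δ hδ)

theorem apLe_trans {F : (Fin d → ℝ) → Fin d → ℝ} {M M0 : Set (Fin d → ℝ)} {x y z : Fin d → ℝ}
    (h : apLe F M M0 x y) (h' : apLe F M M0 y z) : apLe F M M0 x z := by
  rw [apLe_iff] at *
  exact fun δ hδ => (h δ hδ).trans (h' δ hδ)

theorem apLe_mem {F : (Fin d → ℝ) → Fin d → ℝ} {M M0 : Set (Fin d → ℝ)} {x y : Fin d → ℝ}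
    (h : apLe F M M0 x y) : x ∈ M := by
  obtain ⟨n, ξ, ho, rfl, -⟩ := h 1 one_pos
  exact ho.2.1 0 (by omega)

theorem ApStep.mono {F : (Fin d → ℝ) → Fin d → ℝ} {M M0 : Set (Fin d → ℝ)} {δ δ' : ℝ}
    (hd : δ ≤ δ') {x y : Fin d → ℝ} (h : ApStep F M M0 δ x y) : ApStep F M M0 δ' x y :=
  ⟨h.1, h.2.1, h.2.2.1, h.2.2.2.trans_le hd⟩

theorem apLe_image {F : (Fin d → ℝ) → Fin d → ℝ} {M M0 : Set (Fin d → ℝ)}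
    (hFmap : MapsTo F M M) (hFM0 : MapsTo F M0 M0) {y : Fin d → ℝ} (hy : y ∈ M) :
    apLe F M M0 y (F y) := by
  rw [apLe_iff]
  exact fun δ hδ => .single ⟨hy, hFmap hy, fun h => hFM0 h, by simpa using hδ⟩

theorem apLe_image_self {F : (Fin d → ℝ) → Fin d → ℝ} {M M0 : Set (Fin d → ℝ)}
    (hFmap : MapsTo F M M) (hFcont : ContinuousOn F M)
    (hFM1 : MapsTo F (M \ M0) (M \ M0)) {y : Fin d → ℝ} (h : apLe F M M0 y y) :
    apLe F M M0 (F y) y := by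
  have hy := apLe_mem h
  rw [apLe_iff] at *
  intro δ hδ
  obtain ⟨η, hη, hc⟩ := Metric.continuousOn_iff.1 hFcont (F y) (hFmap hy) (δ / 2) (by linarith)
  have hm : 0 < min η (δ / 2) := lt_min hη (by linarith)
  have hT := h _ hm
  obtain ⟨c, hyc, hcy⟩ := Relation.TransGen.head'_iff.1 hT
  obtain ⟨e, hce, hey⟩ := Relation.TransGen.head'_iff.1 (Relation.TransGen.trans_right hcy hT)
  refine Relation.TransGen.head' (b := e) ⟨hFmap hy, hce.2.1, ?_, ?_⟩
    (Relation.ReflTransGen.mono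
      (fun a b hab => hab.mono ((min_le_right _ _).trans (by linarith))) _ _ hey)
  · intro h0
    have hy0 : y ∈ M0 := by
      by_contra hn
      exact (hFM1 ⟨hy, hn⟩).2 h0
    exact hce.2.2.1 (hyc.2.2.1 hy0)
  · have h1 := hc c hyc.2.1 (hyc.2.2.2.trans_le (min_le_left _ _))
    have h2 := hce.2.2.2.trans_le (min_le_right _ _)
    linarith [dist_triangle e (F c) (F (F y))]

theorem exists_preimage {F : (Fin d → ℝ) → Fin d → ℝ} {M M0 : Set (Fin d → ℝ)}
    (hMcl : IsClosed M) (hFcont : ContinuousOn F M)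
    (hFbdd : ∃ C : ℝ, ∀ x ∈ M, ‖F x‖ ≤ C) (hFM0 : MapsTo F M0 M0)
    {y : Fin d → ℝ} (hy0 : y ∉ M0) (h : apLe F M M0 y y) :
    ∃ z ∈ M, F z = y ∧ apLe F M M0 y z := by
  rw [apLe_iff] at h
  have hk : ∀ k : ℕ, ∃ v w, Relation.ReflTransGen (ApStep F M M0 (1 / ((k : ℝ) + 1))) y v ∧
      ApStep F M M0 (1 / ((k : ℝ) + 1)) v w ∧ ApStep F M M0 (1 / ((k : ℝ) + 1)) w y := by
    intro k
    have hT := h (1 / ((k : ℝ) + 1)) (by positivity)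
    obtain ⟨w, hyw, hwy⟩ := Relation.TransGen.tail'_iff.1 hT
    obtain ⟨v, hyv, hvw⟩ := Relation.TransGen.tail'_iff.1 (Relation.TransGen.trans_left hT hyw)
    exact ⟨v, w, hyv, hvw, hwy⟩
  choose v w hyv hvw hwy using hk
  obtain ⟨C, hC⟩ := hFbdd
  have hle1 : ∀ k : ℕ, 1 / ((k : ℝ) + 1) ≤ 1 := by
    intro k
    rw [div_le_one (by positivity)]
    have : (0 : ℝ) ≤ k := by positivity
    linarith
  have hwb : ∀ k, w k ∈ closedBall (0 : Fin d → ℝ) (C + 1) ∩ M := by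
    intro k
    refine ⟨?_, (hwy k).1⟩
    have h1 := (hvw k).2.2.2
    have h2 := hC _ (hvw k).1
    have h3 := dist_triangle (w k) (F (v k)) 0
    rw [dist_zero_right (F (v k))] at h3
    rw [mem_closedBall]
    linarith [hle1 k]
  obtain ⟨z, hz, φ, hφ, hlim⟩ :=
    ((isCompact_closedBall (0 : Fin d → ℝ) (C + 1)).inter_right hMcl).tendsto_subseq hwb
  have hd0 : Tendsto (fun k => 1 / ((φ k : ℝ) + 1)) atTop (𝓝 0) :=
    (tendsto_one_div_add_atTop_nhds_zero_nat (𝕜 := ℝ)).comp hφ.tendsto_atTop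
  have hFz : F z = y := by
    have t1 : Tendsto (fun k => F (w (φ k))) atTop (𝓝 (F z)) :=
      (hFcont z hz.2).tendsto.comp
        (tendsto_nhdsWithin_iff.2 ⟨hlim, Eventually.of_forall fun k => (hwb _).2⟩)
    have t2 : Tendsto (fun k => F (w (φ k))) atTop (𝓝 y) := by
      rw [tendsto_iff_dist_tendsto_zero]
      refine squeeze_zero (fun _ => dist_nonneg) (fun k => ?_) hd0
      rw [dist_comm]
      exact (hwy (φ k)).2.2.2.le
    exact tendsto_nhds_unique t1 t2
  refine ⟨z, hz.2, hFz, ?_⟩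
  rw [apLe_iff]
  intro δ hδ
  have e1 := hd0.eventually (gt_mem_nhds (show (0 : ℝ) < δ / 2 by linarith))
  have e2 := (Metric.tendsto_nhds.1 hlim) (δ / 2) (by linarith)
  obtain ⟨k, hk1, hk2⟩ := (e1.and e2).exists
  refine Relation.TransGen.tail' (b := v (φ k)) (Relation.ReflTransGen.mono
      (fun a b hab => hab.mono (by linarith)) _ _ (hyv (φ k))) ⟨(hvw _).1, hz.2, ?_, ?_⟩
  · intro hv0
    exact absurd ((hwy (φ k)).2.2.1 ((hvw (φ k)).2.2.1 hv0)) hy0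
  · have h1 := (hvw (φ k)).2.2.2
    have h2 := dist_triangle z (w (φ k)) (F (v (φ k)))
    rw [dist_comm z (w (φ k))] at h2
    simp only [Function.comp] at hk2
    linarith

theorem stmt3 (d : ℕ) (M M0 : Set (Fin d → ℝ)) (F : (Fin d → ℝ) → Fin d → ℝ)
    (hMcl : IsClosed M) (hM0cl : IsClosed M0) (hM0M : M0 ⊆ M)
    (hFmap : MapsTo F M M) (hFcont : ContinuousOn F M)
    (hFbdd : ∃ C : ℝ, ∀ x ∈ M, ‖F x‖ ≤ C)
    (hFM0 : MapsTo F M0 M0) (hFM1 : MapsTo F (M \ M0) (M \ M0))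
    (x : Fin d → ℝ) (hx : x ∈ apRec F M M0) :
    F '' apClass F M M0 x ⊆ apClass F M M0 x ∧
    (closure (apClass F M M0 x) ⊆ M \ M0 → F '' apClass F M M0 x = apClass F M M0 x) := by
  have h1 : F '' apClass F M M0 x ⊆ apClass F M M0 x := by
    rintro _ ⟨y, ⟨hyR, hxy⟩, rfl⟩
    have a := apLe_image (M0 := M0) hFmap hFM0 (apLe_mem hyR.1)
    have b := apLe_image_self hFmap hFcont hFM1 hyR.1
    exact ⟨⟨apLe_trans b a, apLe_trans b a⟩, apLe_trans hxy.1 a, apLe_trans b hxy.2⟩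
  refine ⟨h1, fun hcl => h1.antisymm ?_⟩
  intro y hy
  obtain ⟨z, hzM, hFz, hyz⟩ := exists_preimage hMcl hFcont hFbdd hFM0
    (hcl (subset_closure hy)).2 hy.1.1
  have hzy : apLe F M M0 z y := hFz ▸ apLe_image (M0 := M0) hFmap hFM0 hzM
  exact ⟨z, ⟨⟨apLe_trans hzy hyz, apLe_trans hzy hyz⟩, apLe_trans hy.2.1 hyz,
    apLe_trans hzy hy.2.2⟩, hFz⟩

end QSDPaper
end
end

section
/- For every x ∈ M, the ω-limit set of x meets the ap-chain recurrent set: ω(x) ∩ R_ap ≠ ∅. -/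
open MeasureTheory ProbabilityTheory Metric Set Filter Topology
open scoped ENNReal NNReal

noncomputable section

namespace QSDPaper

variable {d : ℕ}

theorem omega_iff (F : (Fin d → ℝ) → Fin d → ℝ) (x z : Fin d → ℝ) :
    z ∈ omegaSet F x ↔ ∀ ε > (0 : ℝ), ∀ N : ℕ, ∃ n ≥ N, dist (F^[n] x) z < ε := by
  constructor
  · rintro ⟨φ, hφ, ht⟩ ε hε N
    obtain ⟨k, hk, hkN⟩ := (((Metric.tendsto_nhds.1 ht) ε hε).and (eventually_ge_atTop N)).exists
    exact ⟨φ k, hkN.trans (hφ.id_le k), hk⟩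
  · intro h
    have hc : MapClusterPt z atTop (fun n => F^[n] x) := by
      rw [mapClusterPt_iff_frequently]
      intro s hs
      obtain ⟨ε, hε, hb⟩ := Metric.mem_nhds_iff.1 hs
      rw [frequently_atTop]
      intro N
      obtain ⟨n, hn, hd⟩ := h ε hε N
      exact ⟨n, hn, hb hd⟩
    exact MapClusterPt.tendsto_subseq hc

theorem iter_mem {F : (Fin d → ℝ) → Fin d → ℝ} {S : Set (Fin d → ℝ)} (h : MapsTo F S S)
    {x : Fin d → ℝ} (hx : x ∈ S) (n : ℕ) : F^[n] x ∈ S := h.iterate n hx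

theorem omega_mem {F : (Fin d → ℝ) → Fin d → ℝ} {S : Set (Fin d → ℝ)} (hS : IsClosed S)
    (h : MapsTo F S S) {x z : Fin d → ℝ} (hx : x ∈ S) (hz : z ∈ omegaSet F x) : z ∈ S := by
  obtain ⟨φ, hφ, ht⟩ := hz
  exact hS.mem_of_tendsto ht (Eventually.of_forall fun k => iter_mem h hx _)

theorem omega_nonempty {F : (Fin d → ℝ) → Fin d → ℝ} {M : Set (Fin d → ℝ)}
    (h : MapsTo F M M) (hb : ∃ C : ℝ, ∀ x ∈ M, ‖F x‖ ≤ C) {x : Fin d → ℝ} (hx : x ∈ M) :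
    (omegaSet F x).Nonempty := by
  obtain ⟨C, hC⟩ := hb
  have hm : ∀ n, F^[n + 1] x ∈ closedBall (0 : Fin d → ℝ) C := by
    intro n
    rw [Function.iterate_succ_apply', mem_closedBall_zero_iff]
    exact hC _ (iter_mem h hx n)
  obtain ⟨z, -, φ, hφ, ht⟩ := (isCompact_closedBall (0 : Fin d → ℝ) C).tendsto_subseq hm
  exact ⟨z, fun k => φ k + 1, fun a b hab => Nat.add_lt_add_right (hφ hab) 1, ht⟩

theorem omega_trans {F : (Fin d → ℝ) → Fin d → ℝ} {M : Set (Fin d → ℝ)} (hMcl : IsClosed M)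
    (h : MapsTo F M M) (hc : ContinuousOn F M) {x y z : Fin d → ℝ} (hx : x ∈ M)
    (hy : y ∈ omegaSet F x) (hz : z ∈ omegaSet F y) : z ∈ omegaSet F x := by
  have hyM := omega_mem hMcl h hx hy
  rw [omega_iff] at hz ⊢
  intro ε hε N
  obtain ⟨m, hm, hd⟩ := hz (ε / 2) (half_pos hε) N
  obtain ⟨φ, hφ, ht⟩ := hy
  have hcm : ContinuousOn F^[m] M := hc.iterate h m
  have ht' : Tendsto (fun k => F^[φ k] x) atTop (𝓝[M] y) :=
    tendsto_nhdsWithin_iff.2 ⟨ht, Eventually.of_forall fun k => iter_mem h hx _⟩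
  have ht2 := (hcm y hyM).tendsto.comp ht'
  obtain ⟨k, hk⟩ := ((Metric.tendsto_nhds.1 ht2) (ε / 2) (half_pos hε)).exists
  refine ⟨m + φ k, by omega, ?_⟩
  rw [Function.iterate_add_apply]
  have := dist_triangle (F^[m] (F^[φ k] x)) (F^[m] y) z
  simp only [Function.comp] at hk
  linarith

theorem rec_of {F : (Fin d → ℝ) → Fin d → ℝ} {M M0 : Set (Fin d → ℝ)} (hMcl : IsClosed M)
    (h : MapsTo F M M) (hc : ContinuousOn F M) {y z : Fin d → ℝ} (hy : y ∈ M)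
    (hz : z ∈ omegaSet F y)
    (hap : ((∀ i, F^[i] y ∈ M0) ∧ z ∈ M0) ∨ ((∀ i, F^[i] y ∉ M0) ∧ z ∉ M0)) :
    z ∈ apRec F M M0 := by
  have hzM := omega_mem hMcl h hy hz
  suffices H : apLe F M M0 z z from ⟨H, H⟩
  intro δ hδ
  obtain ⟨φ, hφ, ht⟩ := hz
  have ht' : Tendsto (fun k => F^[φ k] y) atTop (𝓝[M] z) :=
    tendsto_nhdsWithin_iff.2 ⟨ht, Eventually.of_forall fun k => iter_mem h hy _⟩
  have ht2 := (hc z hzM).tendsto.comp ht'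
  obtain ⟨k, hk⟩ := eventually_atTop.1
    (((Metric.tendsto_nhds.1 ht2) δ hδ).and ((Metric.tendsto_nhds.1 ht) δ hδ))
  have h1 := hφ (Nat.lt_succ_self k)
  have h2 := hφ (Nat.lt_succ_self (k + 1))
  have hA := (hk k le_rfl).1
  have hB := (hk (k + 1 + 1) (by omega)).2
  simp only [Function.comp, Nat.succ_eq_add_one] at hA h1 h2
  obtain ⟨n, hn⟩ : ∃ n, φ (k + 1 + 1) = φ k + n := ⟨φ (k + 1 + 1) - φ k, by omega⟩
  have hn2 : 2 ≤ n := by omega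
  rw [hn] at hB
  refine ⟨n, fun i => if i = 0 ∨ i = n then z else F^[φ k + i] y, ⟨by omega, ?_, ?_, ?_⟩,
    by simp, by simp⟩
  · intro i _
    dsimp only
    split_ifs
    · exact hzM
    · exact iter_mem h hy _
  · intro i _
    dsimp only
    rcases hap with ⟨ha, hb⟩ | ⟨ha, hb⟩
    · intro _
      split_ifs <;> first | exact hb | exact ha _
    · intro hi
      split_ifs at hi
      · exact absurd hi hb
      · exact absurd hi (ha _)
  · intro i hi
    dsimp only
    by_cases h0 : i = 0
    · subst h0
      rw [if_neg (by omega), if_pos (by simp), zero_add, Function.iterate_succ_apply']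
      exact hA
    · rw [if_neg (show ¬ (i = 0 ∨ i = n) by omega), ← Function.iterate_succ_apply' F]
      by_cases h3 : i + 1 = n
      · rw [if_pos (Or.inr h3), dist_comm]
        subst h3
        exact hB
      · rw [if_neg (by omega)]
        simpa [add_assoc] using hδ

theorem stmt4 (d : ℕ) (M M0 : Set (Fin d → ℝ)) (F : (Fin d → ℝ) → Fin d → ℝ)
    (hMcl : IsClosed M) (hM0cl : IsClosed M0) (hM0M : M0 ⊆ M)
    (hFmap : MapsTo F M M) (hFcont : ContinuousOn F M)
    (hFbdd : ∃ C : ℝ, ∀ x ∈ M, ‖F x‖ ≤ C)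
    (hFM0 : MapsTo F M0 M0) (hFM1 : MapsTo F (M \ M0) (M \ M0)) :
    ∀ x ∈ M, (omegaSet F x ∩ apRec F M M0).Nonempty := by
  intro x hx
  by_cases hcase : ∃ y ∈ omegaSet F x, y ∈ M0
  · obtain ⟨y, hy, hy0⟩ := hcase
    obtain ⟨z, hz⟩ := omega_nonempty hFmap hFbdd (hM0M hy0)
    exact ⟨z, omega_trans hMcl hFmap hFcont hx hy hz, rec_of hMcl hFmap hFcont (hM0M hy0) hz
      (Or.inl ⟨fun i => iter_mem hFM0 hy0 i, omega_mem hM0cl hFM0 hy0 hz⟩)⟩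
  · push Not at hcase
    obtain ⟨z, hz⟩ := omega_nonempty hFmap hFbdd hx
    have hx0 : x ∉ M0 := fun hx0 => hcase z hz (omega_mem hM0cl hFM0 hx0 hz)
    exact ⟨z, hz, rec_of hMcl hFmap hFcont hx hz
      (Or.inr ⟨fun i => (iter_mem hFM1 ⟨hx, hx0⟩ i).2, hcase z hz⟩)⟩

end QSDPaper
end
end

section
/- Let ε_n ↓ 0 and for each n let μ_n be a quasi-stationary distribution for p^{ε_n} with eigenvalue λ_n ∈ (0,1), and assume μ_n converges weakly to a Borel probability measure μ. If λ_n → 1, then μ is F-invariant (μ(F^{-1}(Γ)) = μ(Γ) for all Borel Γ ⊆ M), and consequently μ is supported by the closure of the ap-chain recurrent set R_ap. -/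
open MeasureTheory ProbabilityTheory Metric Set Filter Topology
open scoped ENNReal NNReal

noncomputable section

namespace QSDPaper

variable {d : ℕ}

theorem meas_eq_of_key {μ ν : Measure (Fin d → ℝ)} [IsProbabilityMeasure μ]
    [IsProbabilityMeasure ν]
    (h : ∀ K : Set (Fin d → ℝ), IsClosed K → ∀ δ > (0 : ℝ),
      μ (thickening δ K) ≤ ν (cthickening (2 * δ) K)) : μ = ν := by
  have h1 : ∀ K : Set (Fin d → ℝ), IsClosed K → μ K ≤ ν K := by
    intro K hK
    have ht : Tendsto (fun r => ν (cthickening r K)) (𝓝 0) (𝓝 (ν K)) :=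
      tendsto_measure_cthickening_of_isClosed ⟨1, one_pos, measure_ne_top _ _⟩ hK
    have ht2 : Tendsto (fun δ : ℝ => 2 * δ) (𝓝[>] 0) (𝓝 0) := by
      have : Tendsto (fun δ : ℝ => 2 * δ) (𝓝 0) (𝓝 (2 * 0)) :=
        (continuous_const.mul continuous_id).tendsto 0
      rw [mul_zero] at this
      exact this.mono_left nhdsWithin_le_nhds
    refine ge_of_tendsto (ht.comp ht2) ?_
    filter_upwards [self_mem_nhdsWithin] with δ hδ
    exact (measure_mono (self_subset_thickening hδ K)).trans (h K hK δ hδ)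
  have h2 : ∀ U : Set (Fin d → ℝ), IsOpen U → ν U ≤ μ U := by
    intro U hU
    have := h1 Uᶜ hU.isClosed_compl
    rw [prob_compl_eq_one_sub hU.measurableSet, prob_compl_eq_one_sub hU.measurableSet] at this
    exact (ENNReal.sub_le_sub_iff_left prob_le_one ENNReal.one_ne_top).1 this
  have h3 : ∀ K : Set (Fin d → ℝ), IsClosed K → ν K ≤ μ K := by
    intro K hK
    have ht : Tendsto (fun r => μ (thickening r K)) (𝓝[>] 0) (𝓝 (μ K)) :=
      tendsto_measure_thickening_of_isClosed ⟨1, one_pos, measure_ne_top _ _⟩ hK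
    refine ge_of_tendsto ht ?_
    filter_upwards [self_mem_nhdsWithin] with δ hδ
    exact (measure_mono (self_subset_thickening hδ K)).trans (h2 _ isOpen_thickening)
  refine ext_of_generate_finite _ ?_ isPiSystem_isClosed
    (fun A hA => le_antisymm (h1 A hA) (h3 A hA)) (by simp)
  rw [BorelSpace.measurable_eq (α := Fin d → ℝ), borel_eq_generateFrom_isClosed]

theorem qsd_bound {M M0 : Set (Fin d → ℝ)} {F : (Fin d → ℝ) → Fin d → ℝ}
    (hMcl : IsClosed M) (hM0cl : IsClosed M0) (hFcont : ContinuousOn F M)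
    (p : ℝ → Kernel (Fin d → ℝ) (Fin d → ℝ)) (ε : ℝ)
    [IsMarkovKernel (p ε)] (ν : Measure (Fin d → ℝ)) (l : ℝ) (hQ : IsQSD (p ε) (M \ M0) ν l)
    (K : Set (Fin d → ℝ)) (δ : ℝ) :
    ν (thickening δ K) ≤ (ENNReal.ofReal (1 - l) + beta p F M δ ε) +
      ν (M ∩ F ⁻¹' cthickening (2 * δ) K) := by
  obtain ⟨hν, hM1, hl0, hl1, hq⟩ := hQ
  have hmM1 : MeasurableSet (M \ M0) := hMcl.measurableSet.diff hM0cl.measurableSet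
  have hU : MeasurableSet (thickening δ K) := isOpen_thickening.measurableSet
  set C := M ∩ F ⁻¹' cthickening (2 * δ) K with hC
  have hCm : MeasurableSet C :=
    (hFcont.preimage_isClosed_of_isClosed hMcl isClosed_cthickening).measurableSet
  have e1 : ν (thickening δ K) = ν (thickening δ K ∩ (M \ M0)) := by
    rw [measure_inter_conull]
    exact (prob_compl_eq_zero_iff hmM1).2 hM1
  have pt : ∀ x ∈ M \ M0, p ε x (thickening δ K ∩ (M \ M0)) ≤
      beta p F M δ ε + C.indicator (fun _ => p ε x univ) x := by
    intro x hx
    by_cases hxC : x ∈ C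
    · rw [indicator_of_mem hxC]
      exact (measure_mono (subset_univ _)).trans le_add_self
    · refine le_trans ?_ le_self_add
      refine le_trans (measure_mono ?_)
        (le_iSup₂ (f := fun x (_ : x ∈ M) => p ε x (M \ ball (F x) δ)) x hx.1)
      rintro y ⟨hy, hyM, -⟩
      refine ⟨hyM, fun hyb => hxC ⟨hx.1, ?_⟩⟩
      obtain ⟨z, hz, hyz⟩ := mem_thickening_iff.1 hy
      apply thickening_subset_cthickening
      refine mem_thickening_iff.2 ⟨z, hz, ?_⟩
      have := dist_triangle (F x) y z
      rw [mem_ball, dist_comm] at hyb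
      linarith
  have hfin : ENNReal.ofReal l * ν (thickening δ K) ≤ beta p F M δ ε + ν C := by
    rw [e1, ← hq _ (hU.inter hmM1) inter_subset_right]
    calc _ ≤ ∫⁻ x in M \ M0, (beta p F M δ ε + C.indicator 1 x) ∂ν :=
          setLIntegral_mono' hmM1 (fun x hx => by simpa [indicator] using pt x hx)
      _ ≤ ∫⁻ x, (beta p F M δ ε + C.indicator 1 x) ∂ν := setLIntegral_le_lintegral _ _
      _ = _ := by
        rw [lintegral_add_left measurable_const, lintegral_const, measure_univ, mul_one,
          lintegral_indicator_one hCm]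
  calc ν (thickening δ K)
      = (ENNReal.ofReal (1 - l) + ENNReal.ofReal l) * ν (thickening δ K) := by
        rw [← ENNReal.ofReal_add (by linarith) hl0.le]
        simp
    _ = ENNReal.ofReal (1 - l) * ν (thickening δ K) +
        ENNReal.ofReal l * ν (thickening δ K) := add_mul _ _ _
    _ ≤ ENNReal.ofReal (1 - l) * 1 + (beta p F M δ ε + ν C) := by
        gcongr
        exact prob_le_one
    _ = _ := by rw [mul_one, add_assoc]

theorem stmt9 (d : ℕ) (M M0 : Set (Fin d → ℝ)) (F : (Fin d → ℝ) → Fin d → ℝ)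
    (hMcl : IsClosed M) (hM0cl : IsClosed M0) (hM0M : M0 ⊆ M)
    (hFmap : MapsTo F M M) (hFcont : ContinuousOn F M)
    (hFbdd : ∃ C : ℝ, ∀ x ∈ M, ‖F x‖ ≤ C)
    (hFM0 : MapsTo F M0 M0) (hFM1 : MapsTo F (M \ M0) (M \ M0))
    (p : ℝ → Kernel (Fin d → ℝ) (Fin d → ℝ))
    (hp : ∀ ε > (0 : ℝ), IsMarkovKernel (p ε))
    (habs : ∀ ε > (0 : ℝ), ∀ x ∈ M0, p ε x (M \ M0) = 0)
    (hbeta : ∀ δ > (0 : ℝ), Tendsto (fun ε => beta p F M δ ε) (𝓝[>] (0 : ℝ)) (𝓝 0))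
    (εs : ℕ → ℝ) (hεpos : ∀ n, 0 < εs n) (hεanti : StrictAnti εs)
    (hεlim : Tendsto εs atTop (𝓝 (0 : ℝ)))
    (μs : ℕ → Measure (Fin d → ℝ)) (lam : ℕ → ℝ)
    (hQSD : ∀ n, IsQSD (p (εs n)) (M \ M0) (μs n) (lam n))
    (μ : Measure (Fin d → ℝ)) (hμ : IsProbabilityMeasure μ)
    (hw : WeaklyTendsto μs μ)
    (hlam : Tendsto lam atTop (𝓝 1)) :
    (∀ Γ : Set (Fin d → ℝ), MeasurableSet Γ → μ (F ⁻¹' Γ) = μ Γ) ∧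
    μ (closure (apRec F M M0)) = 1 := by
  have hps : ∀ n, IsProbabilityMeasure (μs n) := fun n => (hQSD n).1
  have hconv : Tendsto (β := ProbabilityMeasure (Fin d → ℝ)) (fun n => (⟨μs n, hps n⟩ : ProbabilityMeasure (Fin d → ℝ))) atTop
      (@nhds (ProbabilityMeasure (Fin d → ℝ)) _ ⟨μ, hμ⟩) :=
    ProbabilityMeasure.tendsto_iff_forall_integral_tendsto.2 hw
  have hmM1 : MeasurableSet (M \ M0) := hMcl.measurableSet.diff hM0cl.measurableSet
  have hMone : μ M = 1 := by
    refine le_antisymm prob_le_one ?_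
    have h := ProbabilityMeasure.limsup_measure_closed_le_of_tendsto hconv hMcl
    have h2 : ∀ n, μs n M = 1 := fun n =>
      le_antisymm prob_le_one ((hQSD n).2.1 ▸ measure_mono sdiff_subset)
    simpa [h2] using h
  have hMc : μ Mᶜ = 0 := (prob_compl_eq_zero_iff hMcl.measurableSet).2 hMone
  classical
  set G : (Fin d → ℝ) → Fin d → ℝ := M.piecewise F id with hG
  have hGF : ∀ x ∈ M, G x = F x := fun x hx => piecewise_eq_of_mem _ _ _ hx
  have hGm : Measurable G := by
    intro t ht
    rw [hG, piecewise_preimage, Set.ite]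
    refine MeasurableSet.union ?_ (ht.diff hMcl.measurableSet)
    have := hMcl.measurableSet.subtype_image (hFcont.domRestrict.measurable ht)
    rw [domRestrict_eq, preimage_comp, Subtype.image_preimage_coe] at this
    rwa [inter_comm]
  have hpre : ∀ Γ : Set (Fin d → ℝ), μ (M ∩ F ⁻¹' Γ) = μ (G ⁻¹' Γ) := by
    intro Γ
    rw [← measure_inter_conull (s := G ⁻¹' Γ) hMc]
    congr 1
    ext x
    simp only [mem_inter_iff, mem_preimage]
    constructor
    · rintro ⟨h1, h2⟩
      exact ⟨by rwa [hGF x h1], h1⟩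
    · rintro ⟨h2, h1⟩
      exact ⟨h1, by rwa [hGF x h1] at h2⟩
  have hmapP : IsProbabilityMeasure (μ.map G) := Measure.isProbabilityMeasure_map hGm.aemeasurable
  have hεw : Tendsto εs atTop (𝓝[>] 0) :=
    tendsto_nhdsWithin_iff.2 ⟨hεlim, Eventually.of_forall hεpos⟩
  have hinv : μ = μ.map G := by
    apply meas_eq_of_key
    intro K hK δ hδ
    rw [Measure.map_apply hGm isClosed_cthickening.measurableSet, ← hpre]
    have hCc : IsClosed (M ∩ F ⁻¹' cthickening (2 * δ) K) :=
      hFcont.preimage_isClosed_of_isClosed hMcl isClosed_cthickening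
    have he : Tendsto (fun n => ENNReal.ofReal (1 - lam n) + beta p F M δ (εs n)) atTop
        (𝓝 0) := by
      have a : Tendsto (fun n => ENNReal.ofReal (1 - lam n)) atTop (𝓝 0) := by
        have : Tendsto (fun n => 1 - lam n) atTop (𝓝 (1 - 1)) := tendsto_const_nhds.sub hlam
        simpa using ENNReal.tendsto_ofReal this
      simpa using a.add ((hbeta δ hδ).comp hεw)
    have hO := ProbabilityMeasure.le_liminf_measure_open_of_tendsto hconv
      (isOpen_thickening (δ := δ) (E := K))
    have hC := ProbabilityMeasure.limsup_measure_closed_le_of_tendsto hconv hCc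
    simp only [ProbabilityMeasure.coe_mk] at hO hC
    calc μ (thickening δ K) ≤ liminf (fun n => μs n (thickening δ K)) atTop := hO
      _ ≤ limsup (fun n => μs n (thickening δ K)) atTop := liminf_le_limsup
      _ ≤ limsup (fun n => (ENNReal.ofReal (1 - lam n) + beta p F M δ (εs n)) +
            μs n (M ∩ F ⁻¹' cthickening (2 * δ) K)) atTop := by
          refine limsup_le_limsup (Eventually.of_forall fun n => ?_)
          have := hp (εs n) (hεpos n)
          exact qsd_bound hMcl hM0cl hFcont p (εs n) (μs n) (lam n) (hQSD n) K δ
      _ = limsup (fun n => μs n (M ∩ F ⁻¹' cthickening (2 * δ) K)) atTop :=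
          ENNReal.limsup_add_of_left_tendsto_zero he _
      _ ≤ μ (M ∩ F ⁻¹' cthickening (2 * δ) K) := hC
  refine ⟨fun Γ hΓ => ?_, ?_⟩
  · rw [← measure_inter_conull (s := F ⁻¹' Γ) hMc, inter_comm, hpre]
    conv_rhs => rw [hinv]
    rw [Measure.map_apply hGm hΓ]
  · have hmp : MeasurePreserving G μ μ := ⟨hGm, hinv.symm⟩
    have hae := hmp.conservative.ae_frequently_mem_of_mem_nhds
    have hMae : ∀ᵐ x ∂μ, x ∈ M := hMc
    rw [← prob_compl_eq_zero_iff isClosed_closure.measurableSet]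
    change ∀ᵐ x ∂μ, x ∈ closure (apRec F M M0)
    filter_upwards [hae, hMae] with x hx hxM
    apply subset_closure
    suffices h : apLe F M M0 x x from ⟨h, h⟩
    intro δ hδ
    obtain ⟨n, hn1, hn⟩ := frequently_atTop.1 (hx (ball x δ) (ball_mem_nhds x hδ)) 1
    have hit : ∀ k, G^[k] x ∈ M ∧ (G^[k] x ∈ M0 ↔ x ∈ M0) := by
      intro k
      induction k with
      | zero => exact ⟨hxM, Iff.rfl⟩
      | succ k ih =>
        rw [Function.iterate_succ_apply', hGF _ ih.1]
        refine ⟨hFmap ih.1, ?_⟩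
        rw [← ih.2]
        exact ⟨fun h => by_contra fun h' => (hFM1 ⟨ih.1, h'⟩).2 h, fun h => hFM0 h⟩
    refine ⟨n, fun k => if k < n then G^[k] x else x, ⟨hn1, ?_, ?_, ?_⟩, ?_, ?_⟩
    · intro i _
      dsimp only
      split_ifs
      exacts [(hit i).1, hxM]
    · intro i hi h
      simp only [hi, if_true] at h
      have hx0 := (hit i).2.1 h
      dsimp only
      split_ifs
      exacts [(hit _).2.2 hx0, hx0]
    · intro i hi
      simp only [hi, if_true]
      rw [← hGF _ (hit i).1, ← Function.iterate_succ_apply' G]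
      split_ifs with h
      · simpa using hδ
      · have : i + 1 = n := by omega
        rw [dist_comm, Nat.succ_eq_add_one, this]
        exact hn
    · dsimp only
      rw [if_pos (by omega)]
      rfl
    · simp

end QSDPaper
end
end

section
/- Assume Hypothesis 2.4 (the rate function ρ exists) and Hypothesis 2.5 (for every c > 0 there is an open neighborhood V_0 of M_0 with liminf_{ε→0} inf_{x∈V_0} ε log p^ε(x, M_0) ≥ −c). Then Hypothesis 2.3 holds: for every δ_0 > 0 there exists a neighborhood V_0 of M_0 such that lim_{ε→0} β_{δ_0}(ε) / inf_{x ∈ V_0} p^ε(x, M_0) = 0. -/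
open MeasureTheory ProbabilityTheory Metric Set Filter Topology
open scoped ENNReal NNReal

noncomputable section

namespace QSDPaper

variable {d : ℕ}

theorem le_exp_of_mul_log_le {ε a : ℝ} (hε : 0 < ε) {q : ℝ≥0∞}
    (h : (ε : EReal) * ENNReal.log q ≤ (a : EReal)) :
    q ≤ ENNReal.ofReal (Real.exp (a / ε)) := by
  have h2 : ENNReal.log q ≤ ((a / ε : ℝ) : EReal) := by
    rw [EReal.coe_div]
    rw [EReal.le_div_iff_mul_le (by exact_mod_cast hε) (EReal.coe_ne_top _), mul_comm]
    exact h
  have h3 := EReal.exp_le_exp_iff.2 h2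
  rwa [EReal.exp_coe, ENNReal.exp_log] at h3

theorem exp_le_of_le_mul_log {ε a : ℝ} (hε : 0 < ε) {q : ℝ≥0∞}
    (h : (a : EReal) ≤ (ε : EReal) * ENNReal.log q) :
    ENNReal.ofReal (Real.exp (a / ε)) ≤ q := by
  have h2 : ((a / ε : ℝ) : EReal) ≤ ENNReal.log q := by
    rw [EReal.coe_div]
    rw [EReal.div_le_iff_le_mul (by exact_mod_cast hε) (EReal.coe_ne_top _)]
    first | exact h | (rw [mul_comm]; exact h)
  have h3 := EReal.exp_le_exp_iff.2 h2
  rwa [EReal.exp_coe, ENNReal.exp_log] at h3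

theorem stmt11 (d : ℕ) (M M0 : Set (Fin d → ℝ)) (F : (Fin d → ℝ) → Fin d → ℝ)
    (hMcl : IsClosed M) (hM0cl : IsClosed M0) (hM0M : M0 ⊆ M)
    (hFmap : MapsTo F M M) (hFcont : ContinuousOn F M)
    (hFbdd : ∃ C : ℝ, ∀ x ∈ M, ‖F x‖ ≤ C)
    (hFM0 : MapsTo F M0 M0) (hFM1 : MapsTo F (M \ M0) (M \ M0))
    (p : ℝ → Kernel (Fin d → ℝ) (Fin d → ℝ))
    (hp : ∀ ε > (0 : ℝ), IsMarkovKernel (p ε))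
    (habs : ∀ ε > (0 : ℝ), ∀ x ∈ M0, p ε x (M \ M0) = 0)
    (ρ : (Fin d → ℝ) → (Fin d → ℝ) → ℝ≥0∞)
    (hρ : HypRho F M M0 ρ) (hLD : HypLD p F M M0 ρ) (hAbs : HypAbs p M M0) :
    ∀ δ₀ > (0 : ℝ), ∃ V0 : Set (Fin d → ℝ), IsOpen V0 ∧ M0 ⊆ V0 ∧
      Tendsto (fun ε => beta p F M δ₀ ε / ⨅ x ∈ V0 ∩ M, p ε x M0)
        (𝓝[>] (0 : ℝ)) (𝓝 0) := by
  intro δ hδ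
  obtain ⟨-, -, hρ3⟩ := hρ
  obtain ⟨-, hUp⟩ := hLD
  obtain ⟨c0, hc0, hc0'⟩ := hρ3 (δ / 4) (by positivity)
  -- a real positive lower bound for the rate function
  obtain ⟨c, hc, hcρ⟩ : ∃ c : ℝ, 0 < c ∧ ENNReal.ofReal c ≤ c0 := by
    have hm : min c0 1 ≠ ⊤ := (min_lt_of_right_lt ENNReal.one_lt_top).ne
    refine ⟨(min c0 1).toReal, ENNReal.toReal_pos (lt_min hc0 one_pos).ne' hm, ?_⟩
    rw [ENNReal.ofReal_toReal hm]
    exact min_le_left _ _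
  obtain ⟨V0, hV0, hMV, hlim⟩ := hAbs (c / 3) (by positivity)
  refine ⟨V0, hV0, hMV, ?_⟩
  -- finite cover of the image
  obtain ⟨R, hR⟩ := hFbdd
  have hcov : TotallyBounded (F '' M) := by
    refine TotallyBounded.subset subset_closure (Bornology.IsBounded.isCompact_closure ?_).totallyBounded
    rw [isBounded_iff_forall_norm_le]
    exact ⟨R, by rintro _ ⟨x, hx, rfl⟩; exact hR x hx⟩
  obtain ⟨t, ht, htc⟩ := Metric.totallyBounded_iff.1 hcov (δ / 4) (by positivity)
  have hev : ∀ᶠ ε : ℝ in 𝓝[>] (0 : ℝ), ∀ z ∈ t, ∀ x ∈ M,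
      (ε : EReal) * ENNReal.log (p ε x (M \ ball z (3 * δ / 4))) +
        ((⨅ y ∈ M \ ball z (3 * δ / 4), ρ x y : ℝ≥0∞) : EReal) ≤ ((c / 3 : ℝ) : EReal) := by
    rw [ht.eventually_all]
    intro z _
    exact hUp _ (hMcl.sdiff isOpen_ball) sdiff_subset (c / 3) (by positivity)
  have hlow : ∀ᶠ ε : ℝ in 𝓝[>] (0 : ℝ), ((-(c / 2) : ℝ) : EReal) <
      ⨅ x ∈ V0 ∩ M, (ε : EReal) * ENNReal.log (p ε x M0) := by
    refine eventually_lt_of_lt_liminf (lt_of_lt_of_le ?_ hlim)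
    rw [← EReal.coe_neg]
    exact_mod_cast (by linarith : -(c / 2) < -(c / 3))
  have hpos : ∀ᶠ ε : ℝ in 𝓝[>] (0 : ℝ), 0 < ε := self_mem_nhdsWithin
  have hbound : ∀ᶠ ε : ℝ in 𝓝[>] (0 : ℝ),
      beta p F M δ ε / (⨅ x ∈ V0 ∩ M, p ε x M0) ≤
        ENNReal.ofReal (Real.exp (-(c / 6) * ε⁻¹)) := by
    filter_upwards [hev, hlow, hpos] with ε h1 h2 hε
    have hb : beta p F M δ ε ≤ ENNReal.ofReal (Real.exp (-(2 * c / 3) / ε)) := by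
      refine iSup₂_le fun x hx => ?_
      have hFx := htc (mem_image_of_mem F hx)
      simp only [mem_iUnion, mem_ball, exists_prop] at hFx
      obtain ⟨z, hz, hxz⟩ := hFx
      have hsub : M \ ball (F x) δ ⊆ M \ ball z (3 * δ / 4) := by
        rintro y ⟨hy, hy2⟩
        refine ⟨hy, fun hy3 => hy2 ?_⟩
        rw [mem_ball] at hy3 ⊢
        have := dist_triangle_right y (F x) z
        linarith
      refine (measure_mono hsub).trans (le_exp_of_mul_log_le hε ?_)
      have hinf : ENNReal.ofReal c ≤ ⨅ y ∈ M \ ball z (3 * δ / 4), ρ x y := by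
        refine le_iInf₂ fun y hy => hcρ.trans (hc0' x hx y hy.1 ?_)
        have h3 := hy.2
        rw [mem_ball, not_lt] at h3
        have := dist_triangle y (F x) z
        rw [dist_comm y (F x)] at this
        linarith
      have hinf' : (c : EReal) ≤ ((⨅ y ∈ M \ ball z (3 * δ / 4), ρ x y : ℝ≥0∞) : EReal) := by
        have := EReal.coe_ennreal_le_coe_ennreal_iff.2 hinf
        rwa [EReal.coe_ennreal_ofReal, max_eq_left hc.le] at this
      have h4 := (add_le_add le_rfl hinf').trans (h1 z hz x hx)
      have h5 := EReal.le_sub_iff_add_le (Or.inl (EReal.coe_ne_bot c))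
        (Or.inl (EReal.coe_ne_top c)) |>.2 h4
      rw [← EReal.coe_sub] at h5
      convert h5 using 2
      ring
    have hi : ENNReal.ofReal (Real.exp (-(c / 2) / ε)) ≤ ⨅ x ∈ V0 ∩ M, p ε x M0 :=
      le_iInf₂ fun x hx => exp_le_of_le_mul_log hε (h2.le.trans (iInf₂_le x hx))
    refine (ENNReal.div_le_div hb hi).trans ?_
    rw [← ENNReal.ofReal_div_of_pos (Real.exp_pos _), ← Real.exp_sub]
    apply le_of_eq
    congr 2
    field_simp
    ring
  refine tendsto_of_tendsto_of_tendsto_of_le_of_le' tendsto_const_nhds ?_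
    (Eventually.of_forall fun _ => zero_le) hbound
  rw [← ENNReal.ofReal_zero]
  refine ENNReal.tendsto_ofReal (Real.tendsto_exp_atBot.comp ?_)
  exact tendsto_inv_nhdsGT_zero.const_mul_atTop_of_neg (by linarith)

end QSDPaper
end
end

section
/- Let ρ satisfy properties (i)–(iii) of Hypothesis 2.4 and set α* = sup_{δ>0} inf{ρ(x,y) : x, y ∈ M, d(F(x),y) > δ} ∈ (0, +∞]. Then for any 0 ≤ α < α*, there exists δ > 0 such that every finite sequence ξ = (ξ_0,…,ξ_n) in M with A_n(ξ) < α satisfies ‖ξ_i‖ ≤ ‖F‖ + δ for i = 1,…,n. In particular, the ρ-chain recurrent set R_ρ is bounded. -/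
open MeasureTheory ProbabilityTheory Metric Set Filter Topology
open scoped ENNReal NNReal

noncomputable section

namespace QSDPaper

variable {d : ℕ}

theorem stmt12 (d : ℕ) (M M0 : Set (Fin d → ℝ)) (F : (Fin d → ℝ) → Fin d → ℝ)
    (hMcl : IsClosed M) (hM0cl : IsClosed M0) (hM0M : M0 ⊆ M)
    (hFmap : MapsTo F M M) (hFcont : ContinuousOn F M)
    (hFbdd : ∃ C : ℝ, ∀ x ∈ M, ‖F x‖ ≤ C)
    (hFM0 : MapsTo F M0 M0) (hFM1 : MapsTo F (M \ M0) (M \ M0))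
    (ρ : (Fin d → ℝ) → (Fin d → ℝ) → ℝ≥0∞) (hρ : HypRho F M M0 ρ) :
    (∀ α : ℝ≥0∞,
      α < (⨆ (δ : ℝ) (_ : 0 < δ), ⨅ x ∈ M, ⨅ y ∈ M, ⨅ (_ : δ < dist (F x) y), ρ x y) →
      ∃ δ > (0 : ℝ), ∀ (n : ℕ) (ξ : ℕ → Fin d → ℝ), (∀ i ≤ n, ξ i ∈ M) →
        rhoCost ρ n ξ < α →
        ∀ i, 1 ≤ i → i ≤ n → ‖ξ i‖ ≤ sSup ((fun x => ‖F x‖) '' M) + δ) ∧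
    Bornology.IsBounded (rhoRec ρ M) := by
  have part1 : ∀ α : ℝ≥0∞,
      α < (⨆ (δ : ℝ) (_ : 0 < δ), ⨅ x ∈ M, ⨅ y ∈ M, ⨅ (_ : δ < dist (F x) y), ρ x y) →
      ∃ δ > (0 : ℝ), ∀ (n : ℕ) (ξ : ℕ → Fin d → ℝ), (∀ i ≤ n, ξ i ∈ M) →
        rhoCost ρ n ξ < α →
        ∀ i, 1 ≤ i → i ≤ n → ‖ξ i‖ ≤ sSup ((fun x => ‖F x‖) '' M) + δ := by
    intro α hα
    simp only [lt_iSup_iff] at hα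
    obtain ⟨δ, hδ, hα⟩ := hα
    refine ⟨δ, hδ, ?_⟩
    intro n ξ hξ hc i hi hin
    obtain ⟨j, rfl⟩ : ∃ j, i = j + 1 := ⟨i - 1, by omega⟩
    have hjM : ξ j ∈ M := hξ j (by omega)
    have hj1M : ξ (j + 1) ∈ M := hξ _ hin
    have hle : ρ (ξ j) (ξ (j + 1)) ≤ rhoCost ρ n ξ :=
      Finset.single_le_sum (f := fun i => ρ (ξ i) (ξ (i + 1))) (fun _ _ => zero_le)
        (Finset.mem_range.mpr (by omega))
    have hd : dist (F (ξ j)) (ξ (j + 1)) ≤ δ := by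
      by_contra hlt
      rw [not_le] at hlt
      have h2 : (⨅ x ∈ M, ⨅ y ∈ M, ⨅ (_ : δ < dist (F x) y), ρ x y) ≤ ρ (ξ j) (ξ (j + 1)) :=
        iInf₂_le_of_le _ hjM (iInf₂_le_of_le _ hj1M (iInf_le _ hlt))
      exact absurd (hα.trans_le (h2.trans (hle.trans hc.le))) (lt_irrefl _)
    have hF : ‖F (ξ j)‖ ≤ sSup ((fun x => ‖F x‖) '' M) := by
      obtain ⟨C, hC⟩ := hFbdd
      exact le_csSup ⟨C, by rintro _ ⟨x, hx, rfl⟩; exact hC x hx⟩ ⟨_, hjM, rfl⟩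
    have h3 : ‖ξ (j + 1)‖ ≤ ‖F (ξ j)‖ + ‖F (ξ j) - ξ (j + 1)‖ := norm_le_insert _ _
    rw [← dist_eq_norm] at h3
    linarith
  refine ⟨part1, ?_⟩
  obtain ⟨c, hc, hcρ⟩ := hρ.2.2 1 one_pos
  have hpos : 0 < (⨆ (δ : ℝ) (_ : 0 < δ),
      ⨅ x ∈ M, ⨅ y ∈ M, ⨅ (_ : δ < dist (F x) y), ρ x y) := by
    refine hc.trans_le (le_iSup₂_of_le (1 : ℝ) one_pos ?_)
    exact le_iInf₂ fun x hx => le_iInf₂ fun y hy => le_iInf fun h => hcρ x hx y hy h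
  obtain ⟨α, hα0, hα⟩ := exists_between hpos
  obtain ⟨δ, hδ, H⟩ := part1 α hα
  refine isBounded_iff_forall_norm_le.mpr ⟨sSup ((fun x => ‖F x‖) '' M) + δ, ?_⟩
  intro x hx
  have hB : Brho ρ M x x < α := by
    have : Brho ρ M x x = 0 := hx.1
    rw [this]; exact hα0
  unfold Brho at hB
  simp only [iInf_lt_iff] at hB
  obtain ⟨n, hn, ξ, ⟨h1, h2, h3⟩, h4⟩ := hB
  have := H n ξ h1 h4 n hn le_rfl
  rwa [h3] at this

end QSDPaper
end
end
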